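/- arXiv:1411.7096 — 2 statements merged into one kernel-verified Lean document; each statement's English description precedes it below -/
import Mathlib

section
/- Let (A, m) be an Artinian local ring and let x_1, x_2 ∈ m. Then the first Koszul homology H_1(x_1, x_2; A) cannot be generated by fewer than 2 elements, i.e. ν(H_1(x_1, x_2; A)) ≥ 2. -/
open CategoryTheory

/-- The Koszul complex of a list of elements of `A` with coefficients in the module `M`,
realized as a cochain complex with `K_i` placed in cohomological degree `-i`,
built by iterated mapping cones: `K(a :: xs; M) = cone(a • 𝟙 (K(xs; M)))`. -/
noncomputable def koszulComplex (A : Type) [CommRing A] (M : ModuleCat A) :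
    List A → CochainComplex (ModuleCat A) ℤ
  | [] => (HomologicalComplex.single (ModuleCat A) (ComplexShape.up ℤ) 0).obj M
  | a :: xs => CochainComplex.mappingCone (a • 𝟙 (koszulComplex A M xs))

/-- The `i`-th Koszul homology module `H_i(x₁,...,xₙ; M)`. -/
noncomputable def koszulHomology (A : Type) [CommRing A] (M : ModuleCat A)
    (xs : List A) (i : ℕ) : ModuleCat A :=
  (koszulComplex A M xs).homology (-(i : ℤ))

/-- The minimal number of generators `ν(M)` of a module `M`. -/
noncomputable def minGens (A : Type) [Semiring A] (M : Type) [AddCommMonoid M] [Module A M] : ℕ :=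
  sInf {n | ∃ s : Finset M, s.card = n ∧ Submodule.span A (s : Set M) = ⊤}

/-- A short complex of modules with terms `A`, `A × A`, `A`, given through the components of its
maps, is isomorphic to the corresponding explicit short complex. -/
lemma nonempty_shortComplex_iso_of_components {A : Type} [CommRing A] (x₁ x₂ : A)
    (f : A →ₗ[A] A × A) (hf : ∀ c, f c = (x₁ * c, -(x₂ * c)))
    (g : A × A →ₗ[A] A) (hg : ∀ p, g p = x₂ * p.1 + x₁ * p.2) (h : g.comp f = 0)
    {X₁ X₂ X₃ : ModuleCat.{0} A} (d : X₁ ⟶ X₂) (d' : X₂ ⟶ X₃) (hd : d ≫ d' = 0)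
    (e₁ : X₁ ≅ ModuleCat.of A A) (e₃ : X₃ ≅ ModuleCat.of A A)
    (p₁ p₂ : X₂ ⟶ ModuleCat.of A A) (i₁ i₂ : ModuleCat.of A A ⟶ X₂) (h₁₁ : i₁ ≫ p₁ = 𝟙 _) (h₁₂ : i₁ ≫ p₂ = 0)
    (h₂₁ : i₂ ≫ p₁ = 0) (h₂₂ : i₂ ≫ p₂ = 𝟙 _) (hid : p₁ ≫ i₁ + p₂ ≫ i₂ = 𝟙 _)
    (hf₁ : d ≫ p₁ = x₁ • e₁.hom) (hf₂ : d ≫ p₂ = -(x₂ • e₁.hom))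
    (hg' : d' ≫ e₃.hom = x₂ • p₁ + x₁ • p₂) :
    Nonempty (ShortComplex.mk d d' hd ≅ ModuleCat.shortComplexOfCompEqZero f g h) := by
  let e₂ : X₂ ≅ ModuleCat.of A (A × A) :=
    LinearEquiv.toModuleIso (LinearEquiv.ofLinearMap (p₁.hom.prod p₂.hom) (i₁.hom.coprod i₂.hom)
      (by
        have h₁₁' (a) : p₁ (i₁ a) = a := congr($h₁₁ a)
        have h₁₂' (a) : p₂ (i₁ a) = 0 := congr($h₁₂ a)
        have h₂₁' (a) : p₁ (i₂ a) = 0 := congr($h₂₁ a)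
        have h₂₂' (a) : p₂ (i₂ a) = a := congr($h₂₂ a)
        ext <;> simp [h₁₁', h₁₂', h₂₁', h₂₂'])
      (by
        ext x
        exact congr($hid x)))
  refine ⟨ShortComplex.isoMk e₁ e₂ e₃ ?_ ?_⟩
  · ext x
    · exact (congr(($(hf (e₁.hom x))).1)).trans (congr($hf₁ x)).symm
    · exact (congr(($(hf (e₁.hom x))).2)).trans (congr($hf₂ x)).symm
  · ext x
    exact (hg _).trans (congr($hg' x)).symm

open CochainComplex HomologicalComplex in
/-- The terms of degrees `2`, `1`, `0` of the Koszul complex on two elements are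
`A`, `A × A` and `A`. -/
lemma koszulComplex_pair_shortComplex_iso (A : Type) [CommRing A] (x₁ x₂ : A)
    (f : A →ₗ[A] A × A) (hf : ∀ c, f c = (x₁ * c, -(x₂ * c)))
    (g : A × A →ₗ[A] A) (hg : ∀ p, g p = x₂ * p.1 + x₁ * p.2) (h : g.comp f = 0) :
    Nonempty ((koszulComplex A (ModuleCat.of A A) [x₁, x₂]).sc' (-2) (-1) 0 ≅
      ModuleCat.shortComplexOfCompEqZero f g h) := by
  let S := (HomologicalComplex.single (ModuleCat A) (ComplexShape.up ℤ) 0).obj (ModuleCat.of A A)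
  let s : S.X 0 ≅ ModuleCat.of A A := singleObjXSelf (ComplexShape.up ℤ) 0 (ModuleCat.of A A)
  let K := mappingCone (x₂ • 𝟙 S)
  let φ := x₁ • 𝟙 K
  have hS (i : ℤ) (hi : i ≠ 0) : Limits.IsZero (S.X i) :=
    isZero_single_obj_X _ _ _ _ hi
  have hK (i : ℤ) (hi : i ≠ 0) (hi' : i ≠ -1) : Limits.IsZero (K.X i) := by
    rw [mappingCone.isZero_X_iff]
    exact ⟨hS _ (by lia), hS _ hi⟩
  obtain ⟨K1, K0, hd⟩ : ∃ (K1 : K.X (-1) ≅ ModuleCat.of A A) (K0 : K.X 0 ≅ ModuleCat.of A A),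
      K.d (-1) 0 ≫ K0.hom = x₂ • K1.hom := by
    refine ⟨⟨(mappingCone.fst (x₂ • 𝟙 S)).1.v (-1) 0 (by lia) ≫ s.hom,
      s.inv ≫ (mappingCone.inl (x₂ • 𝟙 S)).v 0 (-1) (by lia), ?_, by simp⟩,
      ⟨(mappingCone.snd (x₂ • 𝟙 S)).v 0 0 (by lia) ≫ s.hom,
      s.inv ≫ (mappingCone.inr (x₂ • 𝟙 S)).f 0, ?_, by simp⟩, ?_⟩
    · apply mappingCone.ext_to _ (-1) 0 (by lia)
      · simp
      · exact (hS (-1) (by lia)).eq_of_tgt _ _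
    · apply mappingCone.ext_to _ 0 1 (by lia)
      · exact (hS 1 (by lia)).eq_of_tgt _ _
      · simp
    · have hz : S.d (-1) 0 = 0 := (hS (-1) (by lia)).eq_of_src _ _
      simp [K, mappingCone.d_snd_v_assoc (x₂ • 𝟙 S) (-1) 0 (by lia), hz]
  change Nonempty (ShortComplex.mk ((mappingCone φ).d (-2) (-1)) ((mappingCone φ).d (-1) 0)
    (d_comp_d _ _ _ _) ≅ _)
  clear_value K
  refine nonempty_shortComplex_iso_of_components x₁ x₂ f hf g hg h
    ((mappingCone φ).d (-2) (-1)) ((mappingCone φ).d (-1) 0) (d_comp_d _ _ _ _)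
    ⟨(mappingCone.fst φ).1.v (-2) (-1) (by lia) ≫ K1.hom,
      K1.inv ≫ (mappingCone.inl φ).v (-1) (-2) (by lia), ?_, by simp⟩
    ⟨(mappingCone.snd φ).v 0 0 (by lia) ≫ K0.hom,
      K0.inv ≫ (mappingCone.inr φ).f 0, ?_, by simp⟩
    ((mappingCone.snd φ).v (-1) (-1) (by lia) ≫ K1.hom)
    ((mappingCone.fst φ).1.v (-1) 0 (by lia) ≫ K0.hom)
    (K1.inv ≫ (mappingCone.inr φ).f (-1))
    (K0.inv ≫ (mappingCone.inl φ).v 0 (-1) (by lia))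
    (by simp) (by simp) (by simp) (by simp) ?_ ?_ ?_ ?_
  · apply mappingCone.ext_to _ (-2) (-1) (by lia)
    · simp
    · exact (hK (-2) (by lia) (by lia)).eq_of_tgt _ _
  · apply mappingCone.ext_to _ 0 1 (by lia)
    · exact (hK 1 (by lia) (by lia)).eq_of_tgt _ _
    · simp
  · apply mappingCone.ext_to _ (-1) 0 (by lia) <;> simp
  · have hz : K.d (-2) (-1) = 0 := (hK (-2) (by lia) (by lia)).eq_of_src _ _
    simp [mappingCone.d_snd_v_assoc φ (-2) (-1) (by lia), hz, φ]
  · simp [mappingCone.d_fst_v_assoc φ (-2) (-1) 0 (by lia) (by lia), hd]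
  · simp [mappingCone.d_snd_v_assoc φ (-1) 0 (by lia), hd, φ, add_comm]

open HomologicalComplex in
/-- The first Koszul homology of a pair, as cycles modulo boundaries. -/
lemma nonempty_koszulHomology_pair_one_equiv (A : Type) [CommRing A] (x₁ x₂ : A)
    (f : A →ₗ[A] A × A) (hf : ∀ c, f c = (x₁ * c, -(x₂ * c)))
    (g : A × A →ₗ[A] A) (hg : ∀ p, g p = x₂ * p.1 + x₁ * p.2) (h : ∀ c, f c ∈ LinearMap.ker g) :
    Nonempty (koszulHomology A (ModuleCat.of A A) [x₁, x₂] 1 ≃ₗ[A]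
      LinearMap.ker g ⧸ LinearMap.range (f.codRestrict _ h)) := by
  obtain ⟨e⟩ := koszulComplex_pair_shortComplex_iso A x₁ x₂ f hf g hg (LinearMap.ext h)
  exact ⟨((homologyIsoSc' _ (-2) (-1) 0 (by simp) (by simp)) ≪≫
    ShortComplex.homologyMapIso e ≪≫ ShortComplex.moduleCatHomologyIso _).toLinearEquiv⟩

/-- A nonzero Artinian local ring has a nonzero socle. -/
lemma IsLocalRing.exists_ne_zero_forall_mem_maximalIdeal_mul_eq_zero
    (A : Type*) [CommRing A] [IsArtinianRing A] [IsLocalRing A] :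
    ∃ a : A, a ≠ 0 ∧ ∀ x ∈ IsLocalRing.maximalIdeal A, x * a = 0 := by
  obtain ⟨p, hp⟩ := associatedPrimes.nonempty A A
  obtain ⟨hp, a, ha⟩ := isAssociatedPrime_iff.mp hp
  have hmem (x : A) : x ∈ p ↔ x * a = 0 := by simp [ha]
  refine ⟨a, ?_, fun x hx ↦ (hmem x).mp ?_⟩
  · rintro rfl
    exact hp.ne_top ((Ideal.eq_top_iff_one p).mpr ((hmem 1).mpr (mul_zero 1)))
  · rwa [IsLocalRing.eq_maximalIdeal hp.isMaximal']

/-- If `z` generates `M` and `I` annihilates `M`, then `M` is at most as long as `A ⧸ I`. -/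
lemma Module.length_le_length_quotient_of_span_singleton_eq_top {A M : Type*} [CommRing A]
    [AddCommGroup M] [Module A M] (I : Ideal A) (hI : ∀ x ∈ I, ∀ m : M, x • m = 0) (z : M)
    (hz : Submodule.span A {z} = ⊤) : Module.length A M ≤ Module.length A (A ⧸ I) := by
  refine Module.length_le_of_surjective (I.liftQ (LinearMap.toSpanSingleton A M z) ?_) ?_
  · intro x hx
    simpa using hI x hx z
  · rw [← LinearMap.range_eq_top, Submodule.range_liftQ, LinearMap.range_toSpanSingleton, hz]

/-- If `(A, m)` is an Artinian local ring and `x₁, x₂ ∈ m`, then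
`ν(H₁(x₁, x₂; A)) ≥ 2`. -/
theorem two_le_number_of_generators_of_first_koszul_homology
    (A : Type) [CommRing A] [IsArtinianRing A] [IsLocalRing A]
    (x₁ x₂ : A) (h₁ : x₁ ∈ IsLocalRing.maximalIdeal A)
    (h₂ : x₂ ∈ IsLocalRing.maximalIdeal A) :
    2 ≤ minGens A ↥(koszulHomology A (ModuleCat.of A A) [x₁, x₂] 1) := by
  let f : A →ₗ[A] A × A := (LinearMap.mulLeft A x₁).prod (-LinearMap.mulLeft A x₂)
  let g : A × A →ₗ[A] A := (LinearMap.mulLeft A x₂).coprod (LinearMap.mulLeft A x₁)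
  have hf (c : A) : f c = (x₁ * c, -(x₂ * c)) := by simp [f]
  have hg (p : A × A) : g p = x₂ * p.1 + x₁ * p.2 := by simp [g]
  have hfg (c : A) : f c ∈ LinearMap.ker g := by
    rw [LinearMap.mem_ker, hg, hf]
    ring
  obtain ⟨e⟩ := nonempty_koszulHomology_pair_one_equiv A x₁ x₂ f hf g hg hfg
  set H := koszulHomology A (ModuleCat.of A A) [x₁, x₂] 1
  have : Module.Finite A H := Module.Finite.equiv e.symm
  have hne : {n | ∃ s : Finset H, s.card = n ∧ Submodule.span A (s : Set H) = ⊤}.Nonempty := by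
    obtain ⟨s, hs⟩ := Module.Finite.fg_top (R := A) (M := H)
    exact ⟨_, s, rfl, hs⟩
  by_contra! hlt
  obtain ⟨s, hs, hspan⟩ := Nat.sInf_mem hne
  obtain ⟨z, hz⟩ : ∃ z : H, Submodule.span A {z} = ⊤ := by
    obtain ⟨z, hz⟩ := Finset.card_le_one_iff_subset_singleton.mp
      (show s.card ≤ 1 from hs.trans_le (Nat.le_of_lt_succ hlt))
    refine ⟨z, top_unique (hspan ▸ Submodule.span_mono ?_)⟩
    exact_mod_cast hz
  let B := LinearMap.range (f.codRestrict _ hfg)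
  let I := LinearMap.range g
  have hQ : Module.length A H ≤ Module.length A (A ⧸ I) := by
    refine Module.length_le_length_quotient_of_span_singleton_eq_top I ?_ z hz
    rintro _ ⟨c, rfl⟩ m
    apply e.injective
    rw [map_smul, map_zero]
    obtain ⟨⟨⟨a, b⟩, hab⟩, hm⟩ := Submodule.mkQ_surjective _ (e m)
    rw [← hm, ← map_smul, Submodule.mkQ_apply, Submodule.Quotient.mk_eq_zero]
    rw [LinearMap.mem_ker, hg] at hab
    refine ⟨c.2 * a - c.1 * b, Subtype.ext ?_⟩
    simp only [LinearMap.codRestrict_apply, hf, hg, Submodule.coe_smul, Prod.smul_mk, smul_eq_mul,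
      Prod.mk.injEq]
    constructor
    · linear_combination -c.1 * hab
    · linear_combination -c.2 * hab
  have l₁ : Module.length A (A × A) = Module.length A (LinearMap.ker g) + Module.length A I :=
    Module.length_eq_add_of_exact (LinearMap.ker g).subtype g.rangeRestrict
      (Submodule.subtype_injective _) g.surjective_rangeRestrict
      (LinearMap.exact_iff.mpr (by simp))
  have l₂ : Module.length A A = Module.length A I + Module.length A (A ⧸ I) :=
    Module.length_eq_add_of_exact I.subtype I.mkQ (Submodule.subtype_injective _)
      (Submodule.mkQ_surjective _) (LinearMap.exact_subtype_mkQ I)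
  have l₃ : Module.length A (LinearMap.ker g) = Module.length A B + Module.length A H :=
    (Module.length_eq_add_of_exact B.subtype B.mkQ (Submodule.subtype_injective _)
      (Submodule.mkQ_surjective _) (LinearMap.exact_subtype_mkQ B)).trans
      congr(_ + $(e.length_eq.symm))
  have l₄ : Module.length A B < Module.length A A := by
    obtain ⟨a, ha, hma⟩ := IsLocalRing.exists_ne_zero_forall_mem_maximalIdeal_mul_eq_zero A
    let φ := f.codRestrict _ hfg
    have l : Module.length A A = Module.length A (LinearMap.ker φ) + Module.length A B :=
      Module.length_eq_add_of_exact (LinearMap.ker φ).subtype φ.rangeRestrict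
        (Submodule.subtype_injective _) φ.surjective_rangeRestrict
        (LinearMap.exact_iff.mpr (by simp))
    have : Nontrivial (LinearMap.ker φ) := by
      refine Submodule.nontrivial_iff_ne_bot.mpr ((Submodule.ne_bot_iff _).mpr ⟨a, ?_, ha⟩)
      refine LinearMap.mem_ker.mpr (Subtype.ext ?_)
      simp [φ, hf, hma x₁ h₁, hma x₂ h₂]
    rw [l]
    exact ENat.lt_add_left Module.length_ne_top Module.length_pos
  rw [Module.length_prod] at l₁
  have t := Module.length_ne_top (R := A) (M := A)
  have t₁ := Module.length_ne_top (R := A) (M := I)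
  have t₂ := Module.length_ne_top (R := A) (M := A ⧸ I)
  have t₃ := Module.length_ne_top (R := A) (M := B)
  have t₄ := Module.length_ne_top (R := A) (M := LinearMap.ker g)
  have t₅ : Module.length A H ≠ ⊤ := (hQ.trans_lt t₂.lt_top).ne
  lift Module.length A A to ℕ using t with n
  lift Module.length A I to ℕ using t₁ with n₁
  lift Module.length A (A ⧸ I) to ℕ using t₂ with n₂
  lift Module.length A B to ℕ using t₃ with n₃
  lift Module.length A (LinearMap.ker g) to ℕ using t₄ with n₄
  lift Module.length A H to ℕ using t₅ with n₅
  norm_cast at *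
  omega
end

section
/- Let k be a field, let R = k[[Y_1,...,Y_m]] be the formal power series ring, and let I be a proper nonzero ideal of R such that R/I is Artinian (i.e. I is primary to the maximal ideal (Y_1,...,Y_m)). Then there exist elements F_1,...,F_m ∈ I which form part of a minimal set of generators of I and which also form a system of parameters of R. -/
open IsLocalRing

/-- In a local ring, an element of `span (S ∪ T)` outside `span S + 𝔪 I` can be exchanged
with an element of `T`, without changing the span. -/
lemma IsLocalRing.exists_mem_span_union_insert_erase_eq {R : Type*} [CommRing R] [IsLocalRing R]
    [DecidableEq R] {I : Ideal R} {S T : Finset R}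
    (hI : Ideal.span ((S ∪ T : Finset R) : Set R) = I) {x : R} (hxI : x ∈ I)
    (hx : x ∉ Ideal.span (S : Set R) ⊔ maximalIdeal R * I) :
    ∃ g ∈ T, Ideal.span ((insert x S ∪ T.erase g : Finset R) : Set R) = I := by
  have hTI : ∀ g ∈ T, g ∈ I := fun g hg ↦ hI ▸ Ideal.subset_span (by simp [hg])
  have hSI : ∀ g ∈ S, g ∈ I := fun g hg ↦ hI ▸ Ideal.subset_span (by simp [hg])
  have hx' : x ∈ Ideal.span (S : Set R) ⊔ Ideal.span (T : Set R) := by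
    rw [← Ideal.span_union, ← Finset.coe_union, hI]
    exact hxI
  obtain ⟨s, hs, t, ht, rfl⟩ := Submodule.mem_sup.mp hx'
  obtain ⟨b, -, rfl⟩ := Submodule.mem_span_finset.mp ht
  obtain ⟨g, hg, hbg⟩ : ∃ g ∈ T, IsUnit (b g) := by
    by_contra! h
    exact hx (Submodule.add_mem_sup hs (Submodule.sum_mem _ fun g hg ↦
      Ideal.mul_mem_mul ((mem_maximalIdeal _).mpr (h g hg)) (hTI g hg)))
  refine ⟨g, hg, le_antisymm ?_ ?_⟩
  · rw [Ideal.span_le]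
    intro y hy
    simp only [Finset.coe_union, Finset.coe_insert, Set.mem_union, Set.mem_insert_iff,
      Finset.mem_coe, Finset.mem_erase] at hy
    rcases hy with (rfl | hy) | hy
    exacts [hxI, hSI y hy, hTI y hy.2]
  · set J := Ideal.span ((insert (s + ∑ a ∈ T, b a • a) S ∪ T.erase g : Finset R) : Set R)
    have hSJ : Ideal.span (S : Set R) ≤ J := Ideal.span_mono fun y hy ↦ by
      simp only [Finset.mem_coe] at hy
      simp [hy]
    have hTJ : ∀ y ∈ T.erase g, y ∈ J := fun y hy ↦
      Ideal.subset_span (Finset.mem_coe.mpr (Finset.mem_union_right _ hy))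
    have hxJ : s + ∑ a ∈ T, b a • a ∈ J := Ideal.subset_span (by simp)
    have hgJ : g ∈ J := by
      rw [J.add_mem_iff_right (hSJ hs), ← Finset.add_sum_erase T _ hg,
        J.add_mem_iff_left (J.sum_mem fun y hy ↦ J.smul_mem _ (hTJ y hy))] at hxJ
      exact (J.unit_mul_mem_iff_mem hbg).mp hxJ
    rw [← hI, Ideal.span_le]
    intro y hy
    rcases Finset.mem_union.mp hy with hy | hy
    · exact hSJ (Ideal.subset_span hy)
    · by_cases hyg : y = g
      · exact hyg ▸ hgJ
      · exact hTJ y (Finset.mem_erase.mpr ⟨hyg, hy⟩)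

/-- In a Noetherian local ring, a proper ideal of height at least `n` has `n` elements which are
part of a minimal set of generators and generate an ideal of height at least `n`. -/
lemma IsLocalRing.exists_finset_part_of_generators_le_height {R : Type*} [CommRing R]
    [IsLocalRing R] [IsNoetherianRing R] [DecidableEq R] {I : Ideal R} (hI : I ≠ ⊤) (n : ℕ)
    (hn : n ≤ I.height) :
    ∃ S T : Finset R, S.card = n ∧ Ideal.span ((S ∪ T : Finset R) : Set R) = I ∧
      n + T.card ≤ I.spanFinrank ∧ n ≤ (Ideal.span (S : Set R)).height := by
  induction n with
  | zero =>
    have hfg : Submodule.FG I := IsNoetherian.noetherian I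
    refine ⟨∅, hfg.finite_generators.toFinset, by simp, ?_, ?_, by simp⟩
    · simpa using I.span_generators
    · rw [← Set.ncard_eq_toFinset_card _ hfg.finite_generators, hfg.generators_ncard, zero_add]
  | succ r ih =>
    have hr : (r : ℕ∞) < I.height := lt_of_lt_of_le (by exact_mod_cast r.lt_succ_self) hn
    obtain ⟨S, T, hS, hST, hT, hht⟩ := ih hr.le
    set J := Ideal.span (S : Set R) with hJ
    have hJI : J ≤ I := hST ▸ Ideal.span_mono (by simp)
    set N := J ⊔ maximalIdeal R * I
    let P : Set (Ideal R) := {K | K ∈ J.minimalPrimes ∧ K.height = r}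
    have hP : P.Finite := J.finite_minimalPrimes_of_isNoetherianRing.subset fun _ h ↦ h.1
    have hN : ¬ I ≤ N := by
      intro h
      have hIJ : I = J := le_antisymm (Submodule.le_of_le_smul_of_le_jacobson_bot
        (IsNoetherian.noetherian I) (maximalIdeal_le_jacobson _) h) hJI
      have h₁ := I.height_le_spanFinrank hI
      have h₂ : I.spanFinrank ≤ r := by
        rw [hIJ, hJ, ← hS, ← Set.ncard_coe_finset]
        exact Submodule.spanFinrank_span_le_ncard_of_finite S.finite_toSet
      exact (hr.trans_le h₁).not_ge (by exact_mod_cast h₂)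
    have havoid : ¬ (I : Set R) ⊆ ⋃ K ∈ insert N P, (K : Set R) := by
      refine (Ideal.subset_union_prime_finite (hP.insert N) N N ?_).not.mpr ?_
      · rintro K (rfl | hK) h -
        exacts [(h rfl).elim, hK.1.isPrime]
      · rintro ⟨K, rfl | hK, hIK⟩
        · exact hN hIK
        · exact (hr.trans_le (Ideal.height_mono hIK)).ne hK.2.symm
    obtain ⟨x, hxI, hx⟩ := Set.not_subset.mp havoid
    simp only [Set.mem_iUnion, not_exists] at hx
    have hxN : x ∉ N := hx N (Set.mem_insert _ _)
    obtain ⟨g, hg, hspan⟩ := exists_mem_span_union_insert_erase_eq hST hxI hxN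
    have hxS : x ∉ S := fun h ↦ hxN (Ideal.mem_sup_left (Ideal.subset_span h))
    refine ⟨insert x S, T.erase g, by rw [Finset.card_insert_of_notMem hxS, hS], hspan, ?_, ?_⟩
    · have := Finset.card_erase_add_one hg
      omega
    · rw [Ideal.height_eq_inf_minimalPrimes]
      refine le_iInf₂ fun p hp ↦ ?_
      have := hp.isPrime
      have hJp : J ≤ p := le_trans (Ideal.span_mono (by simp)) hp.1.2
      have hle : (r : ℕ∞) ≤ p.height := hht.trans (Ideal.height_mono hJp)
      rw [Nat.cast_succ]
      refine Order.add_one_le_of_lt (lt_of_le_of_ne hle fun e ↦ ?_)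
      exact hx p (Set.mem_insert_of_mem _ ⟨Ideal.mem_minimalPrimes_of_height_le hJp
        (e.symm.trans_le hht), e.symm⟩) (hp.1.2 (Ideal.subset_span (by simp)))

/-- If a surjection from a Noetherian local ring has kernel generated by a non-zero-divisor `x`,
it lowers the dimension by one. -/
lemma IsLocalRing.ringKrullDim_eq_add_one_of_surjective {A R : Type*} [CommRing A] [CommRing R]
    [IsLocalRing A] [IsNoetherianRing A] [Nontrivial R] (f : A →+* R)
    (hf : Function.Surjective f) {x : A} (hx : x ∈ nonZeroDivisors A)
    (hker : RingHom.ker f = Ideal.span {x}) : ringKrullDim A = ringKrullDim R + 1 := by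
  rw [← ringKrullDim_eq_of_ringEquiv (RingHom.quotientKerEquivOfSurjective hf),
    ringKrullDim_eq_of_ringEquiv (Ideal.quotEquivOfEq hker)]
  refine (Module.ringKrullDim_quotient_add_one_of_mem_nonZeroDivisors hx
    (p := maximalIdeal A) maximalIdeal_height_eq_ringKrullDim ?_).symm
  refine le_maximalIdeal (RingHom.ker_ne_top f) ?_
  exact hker ▸ Ideal.mem_span_singleton_self x

/-- Over a Noetherian local ring, adjoining a power series variable raises the dimension by one. -/
lemma PowerSeries.ringKrullDim_eq_add_one {R : Type*} [CommRing R] [IsLocalRing R]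
    [IsNoetherianRing R] : ringKrullDim (PowerSeries R) = ringKrullDim R + 1 :=
  ringKrullDim_eq_add_one_of_surjective PowerSeries.constantCoeff
    (fun a ↦ ⟨PowerSeries.C a, by simp⟩) (x := PowerSeries.X) MvPowerSeries.X_mem_nonzeroDivisors
    (Ideal.ext fun f ↦ by
      rw [RingHom.mem_ker, Ideal.mem_span_singleton, PowerSeries.X_dvd_iff])

lemma MvPowerSeries.ringKrullDim_fin (k : Type*) [Field k] (m : ℕ) :
    ringKrullDim (MvPowerSeries (Fin m) k) = m := by
  induction m with
  | zero =>
    rw [ringKrullDim_eq_of_ringEquiv (MvPowerSeries.isEmptyEquiv (R := k) (Fin 0)).toRingEquiv,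
      ringKrullDim_eq_zero_of_field, Nat.cast_zero]
  | succ m ih =>
    rw [ringKrullDim_eq_of_ringEquiv (MvPowerSeries.finSuccEquiv k m).toRingEquiv,
      PowerSeries.ringKrullDim_eq_add_one, ih, Nat.cast_succ]

/-- A proper ideal of a local ring with Artinian quotient has maximal height. -/
lemma IsLocalRing.height_eq_of_isArtinianRing_quotient {R : Type*} [CommRing R] [IsLocalRing R]
    {I : Ideal R} (hI : I ≠ ⊤) [IsArtinianRing (R ⧸ I)] :
    I.height = (maximalIdeal R).height := by
  refine le_antisymm (Ideal.height_mono (le_maximalIdeal hI)) ?_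
  rw [I.height_eq_inf_minimalPrimes]
  refine le_iInf₂ fun p hp ↦ ?_
  have := hp.isPrime
  have hker : RingHom.ker (Ideal.Quotient.mk I) ≤ p := by simpa using hp.1.2
  have : (p.map (Ideal.Quotient.mk I)).IsPrime :=
    Ideal.map_isPrime_of_surjective Ideal.Quotient.mk_surjective hker
  have hmax := Ideal.comap_isMaximal_of_surjective (Ideal.Quotient.mk I)
    Ideal.Quotient.mk_surjective (K := p.map (Ideal.Quotient.mk I))
  rw [Ideal.comap_map_of_surjective' _ Ideal.Quotient.mk_surjective, sup_eq_left.mpr hker] at hmax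
  rw [eq_maximalIdeal hmax]


/-- Let `R = k[[Y₁,...,Yₘ]]` and let `I` be a proper nonzero ideal with `R/I` Artinian.
Then there exist `F₁,...,Fₘ ∈ I` forming part of a minimal set of generators of `I`
(i.e. extendable by further elements to a generating set of minimal cardinality)
which are also a system of parameters of `R` (they generate an ideal primary to the
maximal ideal, expressed via the radical). -/
theorem exists_sop_part_of_minimal_generators (k : Type) [Field k] (m : ℕ)
    (I : Ideal (MvPowerSeries (Fin m) k)) (hI₀ : I ≠ ⊥) (hItop : I ≠ ⊤)
    (hart : IsArtinianRing (MvPowerSeries (Fin m) k ⧸ I)) :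
    ∃ F : Fin m → MvPowerSeries (Fin m) k,
      (∀ j, F j ∈ I) ∧
      (∃ (t : ℕ) (G : Fin t → MvPowerSeries (Fin m) k),
        Ideal.span (Set.range F ∪ Set.range G) = I ∧
        ∀ s : Finset (MvPowerSeries (Fin m) k),
          Ideal.span (s : Set (MvPowerSeries (Fin m) k)) = I → m + t ≤ s.card) ∧
      (Ideal.span (Set.range F)).radical =
        IsLocalRing.maximalIdeal (MvPowerSeries (Fin m) k) := by
  classical
  have hdim : (maximalIdeal (MvPowerSeries (Fin m) k)).height = m := by
    have h := maximalIdeal_height_eq_ringKrullDim (R := MvPowerSeries (Fin m) k)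
    rw [MvPowerSeries.ringKrullDim_fin] at h
    exact_mod_cast h
  obtain ⟨S, T, hS, hST, hT, hht⟩ := exists_finset_part_of_generators_le_height hItop m
    (by rw [height_eq_of_isArtinianRing_quotient hItop, hdim])
  have hrange (U : Finset (MvPowerSeries (Fin m) k)) {n : ℕ} (h : U.card = n) :
      Set.range (fun i ↦ ((U.equivFinOfCardEq h).symm i : MvPowerSeries (Fin m) k)) = U := by
    rw [← Function.comp_def, EquivLike.range_comp Subtype.val]
    exact Subtype.range_coe
  have hSI : Ideal.span (S : Set (MvPowerSeries (Fin m) k)) ≤ I :=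
    hST ▸ Ideal.span_mono (by simp)
  refine ⟨fun i ↦ (S.equivFinOfCardEq hS).symm i, fun j ↦ hSI (Ideal.subset_span (by simp)),
    ⟨T.card, fun i ↦ (T.equivFinOfCardEq rfl).symm i, ?_, fun s hs ↦ hT.trans ?_⟩, ?_⟩
  · rw [hrange, hrange, ← Finset.coe_union, hST]
  · rw [← hs, ← Set.ncard_coe_finset]
    exact Submodule.spanFinrank_span_le_ncard_of_finite s.finite_toSet
  · rw [hrange]
    refine le_antisymm ?_ ?_
    · exact (maximalIdeal.isMaximal _).isPrime.radical_le_iff.mpr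
        (hSI.trans (le_maximalIdeal hItop))
    · rw [Ideal.radical_eq_sInf]
      refine le_sInf fun p ⟨hSp, hp⟩ ↦ ?_
      have := hp
      exact (Ideal.eq_of_le_of_height_le _ (le_maximalIdeal hp.ne_top)
        (hdim.trans_le (hht.trans (Ideal.height_mono hSp)))).ge
end
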